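/- arXiv:1103.5830 — 7 statements merged into one kernel-verified Lean document; each statement's English description precedes it below -/
import Mathlib

section
/- Assume the elements z, e_1, …, e_{m−1}, g_1, …, g_{m−1} of G satisfy the component-group relations of parameters m, n. Then: (a) e_i = (m − i)•e_{m−1} for all 0 ≤ i ≤ m (in particular z = m•e_{m−1}); (b) g_i = (i(nm+1) − (2i−1)m)•e_{m−1} for all 1 ≤ i ≤ m−1; and (c) (m(m(n−2)+2))•e_{m−1} = 0. -/
/-- A sequence in an abelian group whose second differences vanish up to `m` is an arithmetic
progression up to `m`. -/
theorem eq_add_zsmul_of_second_difference_eq_zero {G : Type*} [AddCommGroup G] {m : ℕ} {f : ℕ → G}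
    (hrec : ∀ i, 1 ≤ i → i ≤ m - 1 → f (i - 1) - 2 • f i + f (i + 1) = 0) :
    ∀ i ≤ m, f i = f 0 + (i : ℤ) • (f 1 - f 0) := by
  intro i
  induction i using Nat.twoStepInduction with
  | zero => simp
  | one => simp
  | more k ih₀ ih₁ =>
    intro hk
    have h := hrec (k + 1) (by omega) (by omega)
    rw [Nat.add_sub_cancel, ih₀ (by omega), ih₁ (by omega)] at h
    rw [← sub_eq_zero, ← h]
    push_cast
    module

/-- Theorem 4.3(i)-(ii) of the paper, abstract form: if `z, e₁, …, e_{m-1}, g₁, …, g_{m-1}`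
in an abelian group `G` satisfy the component-group relations of parameters `m, n`
(with the conventions `e 0 = g 0 = z` and `e m = g m = 0`), then
`e i = (m - i) • e (m-1)` for `0 ≤ i ≤ m` (in particular `z = m • e (m-1)`),
`g i = (i(nm+1) - (2i-1)m) • e (m-1)` for `1 ≤ i ≤ m-1`, and
`(m(m(n-2)+2)) • e (m-1) = 0`. -/
theorem component_group_relations {G : Type*} [AddCommGroup G]
    (m n : ℕ) (hm : 2 ≤ m) (hn : 2 ≤ n)
    (z : G) (e g : ℕ → G)
    (he0 : e 0 = z) (hg0 : g 0 = z) (hem : e m = 0) (hgm : g m = 0)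
    (hrel : e 1 + g 1 = n • z)
    (hrece : ∀ i, 1 ≤ i → i ≤ m - 1 → e (i - 1) - 2 • e i + e (i + 1) = 0)
    (hrecg : ∀ i, 1 ≤ i → i ≤ m - 1 → g (i - 1) - 2 • g i + g (i + 1) = 0) :
    (∀ i ≤ m, e i = ((m : ℤ) - (i : ℤ)) • e (m - 1)) ∧
    (∀ i, 1 ≤ i → i ≤ m - 1 →
      g i = ((i : ℤ) * ((n : ℤ) * m + 1) - (2 * (i : ℤ) - 1) * m) • e (m - 1)) ∧
    ((m : ℤ) * ((m : ℤ) * ((n : ℤ) - 2) + 2)) • e (m - 1) = 0 := by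
  have hE := eq_add_zsmul_of_second_difference_eq_zero hrece
  have hF := eq_add_zsmul_of_second_difference_eq_zero hrecg
  have hm_pred : ((m - 1 : ℕ) : ℤ) = (m : ℤ) - 1 := by omega
  have hd : e 1 - e 0 = -e (m - 1) := by
    have h := hE m le_rfl
    rw [hem] at h
    rw [hE (m - 1) (by omega), hm_pred, ← sub_eq_zero]
    refine Eq.trans ?_ h.symm
    module
  have hz : z = (m : ℤ) • e (m - 1) := by
    have h := hE m le_rfl
    rw [hem, hd, he0, smul_neg, ← sub_eq_add_neg] at h
    exact sub_eq_zero.mp h.symm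
  have he : ∀ i ≤ m, e i = ((m : ℤ) - (i : ℤ)) • e (m - 1) := by
    intro i hi
    rw [hE i hi, hd, he0, hz]
    module
  have hg1 : g 1 = ((n : ℤ) * m - m + 1) • e (m - 1) := by
    rw [eq_sub_of_add_eq' hrel, he 1 (by omega), hz]
    push_cast
    module
  have hg : ∀ i ≤ m,
      g i = ((i : ℤ) * ((n : ℤ) * m + 1) - (2 * (i : ℤ) - 1) * m) • e (m - 1) := by
    intro i hi
    rw [hF i hi, hg1, hg0, hz]
    module
  refine ⟨he, fun i _ hi => hg i (by omega), ?_⟩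
  rw [← hgm, hg m le_rfl]
  congr 1
  ring
end

section
/- For all integers m ≥ 1 and n ≥ 2, the group Φ(m,n) is a finite cyclic group of order m(m(n−2)+2); moreover, when m ≥ 2 it is generated by the class of e_{m−1}. -/
open FreeAbelianGroup

/-- Generators of the presented group `Φ(m,n)`: one generator `z` (the `Sum.inl` one),
`m - 1` generators `e 1, …, e (m-1)` and `m - 1` generators `g 1, …, g (m-1)`. -/
abbrev PhiGen (m : ℕ) : Type := Unit ⊕ (Fin (m - 1) ⊕ Fin (m - 1))

/-- The element `e i` of the free abelian group on the generators, for `0 ≤ i ≤ m`,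
with the conventions `e 0 = z` and `e m = 0`. -/
def phiE (m : ℕ) (i : ℕ) : FreeAbelianGroup (PhiGen m) :=
  if i = 0 then of (Sum.inl ())
  else if h : 1 ≤ i ∧ i ≤ m - 1 then of (Sum.inr (Sum.inl ⟨i - 1, by omega⟩))
  else 0

/-- The element `g i` of the free abelian group on the generators, for `0 ≤ i ≤ m`,
with the conventions `g 0 = z` and `g m = 0`. -/
def phiG (m : ℕ) (i : ℕ) : FreeAbelianGroup (PhiGen m) :=
  if i = 0 then of (Sum.inl ())
  else if h : 1 ≤ i ∧ i ≤ m - 1 then of (Sum.inr (Sum.inr ⟨i - 1, by omega⟩))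
  else 0

/-- The defining relation elements of `Φ(m,n)`:  `e 1 + g 1 - n • z` and, for
`1 ≤ i ≤ m - 1`, the elements `e (i-1) - 2 e i + e (i+1)` and `g (i-1) - 2 g i + g (i+1)`. -/
def phiRels (m n : ℕ) : Set (FreeAbelianGroup (PhiGen m)) :=
  {phiE m 1 + phiG m 1 - n • phiE m 0} ∪
    {w | ∃ i, 1 ≤ i ∧ i ≤ m - 1 ∧ w = phiE m (i - 1) - 2 • phiE m i + phiE m (i + 1)} ∪
    {w | ∃ i, 1 ≤ i ∧ i ≤ m - 1 ∧ w = phiG m (i - 1) - 2 • phiG m i + phiG m (i + 1)}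

/-- The group `Φ(m,n)` of Theorem 4.3 of the paper: the abelian group with generators
`z, e 1, …, e (m-1), g 1, …, g (m-1)` and the defining relations `phiRels m n`. -/
abbrev Phi (m n : ℕ) : Type :=
  FreeAbelianGroup (PhiGen m) ⧸ AddSubgroup.closure (phiRels m n)

/-- A sequence that is affine on `0, …, m` and vanishes at `m` is determined by its value at
`m - 1`. -/
theorem eq_nsmul_of_second_difference_eq_zero {A : Type*} [AddCommGroup A] {m : ℕ} {u : ℕ → A}
    (h0 : u m = 0) (hu : ∀ i, 1 ≤ i → i ≤ m - 1 → u (i - 1) - 2 • u i + u (i + 1) = 0)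
    {k : ℕ} (hk : k ≤ m) : u (m - k) = k • u (m - 1) := by
  induction k using Nat.twoStepInduction with
  | zero => simpa using h0
  | one => simp
  | more k ih₁ ih₂ =>
    have h := hu (m - (k + 1)) (by omega) (by omega)
    rw [show m - (k + 1) - 1 = m - (k + 2) by omega, show m - (k + 1) + 1 = m - k by omega,
      ih₁ (by omega), ih₂ (by omega)] at h
    rw [← sub_eq_zero, ← h]
    module

theorem phiE_self {m : ℕ} (hm : 1 ≤ m) : phiE m m = 0 := by
  rw [phiE, if_neg (by omega), dif_neg (by omega)]

theorem phiG_self {m : ℕ} (hm : 1 ≤ m) : phiG m m = 0 := by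
  rw [phiG, if_neg (by omega), dif_neg (by omega)]

theorem phiG_zero (m : ℕ) : phiG m 0 = phiE m 0 := rfl

theorem mk_phiE_second_difference (m n i : ℕ) (h₁ : 1 ≤ i) (h₂ : i ≤ m - 1) :
    (phiE m (i - 1) : Phi m n) - 2 • (phiE m i : Phi m n) + (phiE m (i + 1) : Phi m n) = 0 :=
  (QuotientAddGroup.eq_zero_iff (phiE m (i - 1) - 2 • phiE m i + phiE m (i + 1))).2
    (AddSubgroup.subset_closure (.inl (.inr ⟨i, h₁, h₂, rfl⟩)))

theorem mk_phiG_second_difference (m n i : ℕ) (h₁ : 1 ≤ i) (h₂ : i ≤ m - 1) :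
    (phiG m (i - 1) : Phi m n) - 2 • (phiG m i : Phi m n) + (phiG m (i + 1) : Phi m n) = 0 :=
  (QuotientAddGroup.eq_zero_iff (phiG m (i - 1) - 2 • phiG m i + phiG m (i + 1))).2
    (AddSubgroup.subset_closure (.inr ⟨i, h₁, h₂, rfl⟩))

theorem mk_phiE_one_add_mk_phiG_one (m n : ℕ) :
    (phiE m 1 : Phi m n) + (phiG m 1 : Phi m n) = n • (phiE m 0 : Phi m n) :=
  sub_eq_zero.1 <| (QuotientAddGroup.eq_zero_iff (phiE m 1 + phiG m 1 - n • phiE m 0)).2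
    (AddSubgroup.subset_closure (.inl (.inl rfl)))

theorem mk_phiE_eq {m : ℕ} (n : ℕ) (hm : 1 ≤ m) {i : ℕ} (hi : i ≤ m) :
    (phiE m i : Phi m n) = (m - i) • (phiE m (m - 1) : Phi m n) := by
  have h := eq_nsmul_of_second_difference_eq_zero (u := fun i ↦ (phiE m i : Phi m n))
    (by simp [phiE_self hm]) (mk_phiE_second_difference m n) (Nat.sub_le m i)
  rwa [Nat.sub_sub_self hi] at h

theorem mk_phiG_eq {m : ℕ} (n : ℕ) (hm : 1 ≤ m) {i : ℕ} (hi : i ≤ m) :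
    (phiG m i : Phi m n) = (m - i) • (phiG m (m - 1) : Phi m n) := by
  have h := eq_nsmul_of_second_difference_eq_zero (u := fun i ↦ (phiG m i : Phi m n))
    (by simp [phiG_self hm]) (mk_phiG_second_difference m n) (Nat.sub_le m i)
  rwa [Nat.sub_sub_self hi] at h

theorem nsmul_mk_phiE_eq_nsmul_mk_phiG {m : ℕ} (n : ℕ) (hm : 1 ≤ m) :
    m • (phiE m (m - 1) : Phi m n) = m • (phiG m (m - 1) : Phi m n) := by
  have hE := mk_phiE_eq n hm (Nat.zero_le m)
  have hG := mk_phiG_eq n hm (Nat.zero_le m)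
  rw [phiG_zero, hE] at hG
  simpa using hG

theorem mk_phiG_pred {m n : ℕ} (hm : 1 ≤ m) :
    (phiG m (m - 1) : Phi m n) =
      (1 - (m * (n - 2) + 2) : ℤ) • (phiE m (m - 1) : Phi m n) := by
  have h := mk_phiE_one_add_mk_phiG_one m n
  rw [mk_phiE_eq n hm hm, mk_phiG_eq n hm hm, mk_phiE_eq n hm (Nat.zero_le m)] at h
  have hab := nsmul_mk_phiE_eq_nsmul_mk_phiG n hm
  generalize (phiE m (m - 1) : Phi m n) = a at *
  generalize (phiG m (m - 1) : Phi m n) = b at *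
  simp only [← natCast_zsmul, Nat.cast_sub hm, Nat.sub_zero, Nat.cast_one] at h hab
  linear_combination (norm := module) -h - hab

theorem card_zsmul_mk_phiE_pred {m n : ℕ} (hm : 1 ≤ m) (hn : 2 ≤ n) :
    ((m * (m * (n - 2) + 2) : ℕ) : ℤ) • (phiE m (m - 1) : Phi m n) = 0 := by
  have hab := nsmul_mk_phiE_eq_nsmul_mk_phiG n hm
  rw [mk_phiG_pred hm] at hab
  generalize (phiE m (m - 1) : Phi m n) = a at *
  push_cast [Nat.cast_sub hn]
  rw [← natCast_zsmul, ← natCast_zsmul] at hab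
  linear_combination (norm := module) hab

theorem mem_zmultiples_mk_phiE_pred {m n : ℕ} (hm : 1 ≤ m) (x : Phi m n) :
    x ∈ AddSubgroup.zmultiples (phiE m (m - 1) : Phi m n) := by
  have hE {i : ℕ} (hi : i ≤ m) :
      (phiE m i : Phi m n) ∈ AddSubgroup.zmultiples (phiE m (m - 1) : Phi m n) := by
    rw [mk_phiE_eq n hm hi]
    exact nsmul_mem (AddSubgroup.mem_zmultiples _) _
  have hG {i : ℕ} (hi : i ≤ m) :
      (phiG m i : Phi m n) ∈ AddSubgroup.zmultiples (phiE m (m - 1) : Phi m n) := by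
    rw [mk_phiG_eq n hm hi, mk_phiG_pred hm]
    exact nsmul_mem (zsmul_mem (AddSubgroup.mem_zmultiples _) _) _
  have hof (s : PhiGen m) :
      (of s : Phi m n) ∈ AddSubgroup.zmultiples (phiE m (m - 1) : Phi m n) := by
    rcases s with _ | ⟨i, hi⟩ | ⟨i, hi⟩
    · simpa [phiE] using hE (Nat.zero_le m)
    · simpa [phiE, show i + 1 ≤ m - 1 by omega] using hE (i := i + 1) (by omega)
    · simpa [phiG, show i + 1 ≤ m - 1 by omega] using hG (i := i + 1) (by omega)
  induction x using QuotientAddGroup.induction_on with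
  | H w =>
    induction w using FreeAbelianGroup.induction_on with
    | zero => exact zero_mem _
    | of s => exact hof s
    | neg s _ => exact neg_mem (hof s)
    | add v w hv hw => exact add_mem hv hw

/-- The values on the generators of the isomorphism from `Φ(m,n)` to `ZMod (m(m(n-2)+2))`
sending the class of `e (m-1)` to `1`. -/
def phiWeight (m n : ℕ) : PhiGen m → ZMod (m * (m * (n - 2) + 2))
  | .inl _ => m
  | .inr (.inl i) => m - (i + 1 : ℕ)
  | .inr (.inr i) => (m - (i + 1 : ℕ)) * (1 - (m * (n - 2) + 2))

theorem cast_phi_card_eq_zero (m : ℕ) {n : ℕ} (hn : 2 ≤ n) :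
    (m * (m * (n - 2) + 2) : ZMod (m * (m * (n - 2) + 2))) = 0 := by
  have h := ZMod.natCast_self (m * (m * (n - 2) + 2))
  push_cast [Nat.cast_sub hn] at h
  exact h

theorem lift_phiWeight_phiE {m i : ℕ} (n : ℕ) (hi : i ≤ m) :
    lift (phiWeight m n) (phiE m i) = m - i := by
  rcases Nat.eq_zero_or_pos i with rfl | h0
  · simp [phiE, phiWeight]
  · rcases hi.eq_or_lt with rfl | hlt
    · simp [phiE_self h0]
    · rw [phiE, if_neg h0.ne', dif_pos ⟨h0, by omega⟩, lift_apply_of]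
      simp [phiWeight, Nat.cast_sub (Nat.succ_le_of_lt h0)]

theorem lift_phiWeight_phiG {m n i : ℕ} (hn : 2 ≤ n) (hi : i ≤ m) :
    lift (phiWeight m n) (phiG m i) = (m - i) * (1 - (m * (n - 2) + 2)) := by
  rcases Nat.eq_zero_or_pos i with rfl | h0
  · simp only [phiG, phiWeight, if_true, lift_apply_of]
    linear_combination cast_phi_card_eq_zero m hn
  · rcases hi.eq_or_lt with rfl | hlt
    · simp [phiG_self h0]
    · rw [phiG, if_neg h0.ne', dif_pos ⟨h0, by omega⟩, lift_apply_of]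
      simp [phiWeight, Nat.cast_sub (Nat.succ_le_of_lt h0)]

theorem closure_phiRels_le_ker {m n : ℕ} (hm : 1 ≤ m) (hn : 2 ≤ n) :
    AddSubgroup.closure (phiRels m n) ≤ (lift (phiWeight m n)).ker := by
  rw [AddSubgroup.closure_le]
  rintro _ ((rfl | ⟨i, h₁, h₂, rfl⟩) | ⟨i, h₁, h₂, rfl⟩) <;>
    simp only [SetLike.mem_coe, AddMonoidHom.mem_ker, map_add, map_sub, map_nsmul, nsmul_eq_mul]
  · rw [lift_phiWeight_phiE n hm, lift_phiWeight_phiG hn hm,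
      lift_phiWeight_phiE n (Nat.zero_le m)]
    push_cast
    linear_combination -cast_phi_card_eq_zero m hn
  · rw [lift_phiWeight_phiE n (by omega), lift_phiWeight_phiE n (by omega),
      lift_phiWeight_phiE n (by omega)]
    push_cast [Nat.cast_sub h₁]
    ring
  · rw [lift_phiWeight_phiG hn (by omega), lift_phiWeight_phiG hn (by omega),
      lift_phiWeight_phiG hn (by omega)]
    push_cast [Nat.cast_sub h₁]
    ring

/-- The class of `e (m-1)` has order exactly `m(m(n-2)+2)`. -/
theorem addOrderOf_mk_phiE_pred {m n : ℕ} (hm : 1 ≤ m) (hn : 2 ≤ n) :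
    addOrderOf (phiE m (m - 1) : Phi m n) = m * (m * (n - 2) + 2) := by
  refine Nat.dvd_antisymm ?_ ?_
  · rw [addOrderOf_dvd_iff_nsmul_eq_zero, ← natCast_zsmul]
    exact card_zsmul_mk_phiE_pred hm hn
  · let f : Phi m n →+ ZMod (m * (m * (n - 2) + 2)) :=
      QuotientAddGroup.lift _ (lift (phiWeight m n)) (closure_phiRels_le_ker hm hn)
    have hf : f (phiE m (m - 1) : Phi m n) = 1 := by
      refine (lift_phiWeight_phiE n (Nat.sub_le m 1)).trans ?_
      push_cast [Nat.cast_sub hm]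
      ring
    rw [← ZMod.addOrderOf_one (m * (m * (n - 2) + 2)), ← hf]
    exact addOrderOf_map_dvd f _

/-- Theorem 4.3(i)-(ii) of the paper: for `m ≥ 1` and `n ≥ 2`, the group `Φ(m,n)` is a
finite cyclic group of order `m(m(n-2)+2)`; moreover for `m ≥ 2` it is generated by the
class of `e (m-1)`. -/
theorem phi_cyclic_card (m n : ℕ) (hm : 1 ≤ m) (hn : 2 ≤ n) :
    Finite (Phi m n) ∧ Nat.card (Phi m n) = m * (m * (n - 2) + 2) ∧
    IsAddCyclic (Phi m n) ∧
    (2 ≤ m → ∀ x : Phi m n,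
      ∃ k : ℤ, x = k • (QuotientAddGroup.mk (phiE m (m - 1)) : Phi m n)) := by
  have hgen := mem_zmultiples_mk_phiE_pred (n := n) hm
  have hcard : Nat.card (Phi m n) = m * (m * (n - 2) + 2) := by
    rw [← addOrderOf_mk_phiE_pred hm hn, addOrderOf_eq_card_of_forall_mem_zmultiples hgen]
  refine ⟨Nat.finite_of_card_ne_zero ?_, hcard, ⟨_, hgen⟩, fun _ x ↦ ?_⟩
  · rw [hcard]
    positivity
  · obtain ⟨k, hk⟩ := AddSubgroup.mem_zmultiples_iff.1 (hgen x)
    exact ⟨k, hk.symm⟩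
end

section
/- For all integers m ≥ 1 and n ≥ 2, the quotient of Φ(m,n) by the cyclic subgroup generated by the class of z is a cyclic group of order m. -/
open FreeAbelianGroup

/-- A sequence in an abelian group that starts at `0` and satisfies `a (i-1) - 2 a i + a (i+1) = 0`
up to index `m - 1` is linear up to index `m`. -/
theorem eq_nsmul_of_second_difference_eq_zero_s3 {A : Type*} [AddCommGroup A] (m : ℕ) (a : ℕ → A)
    (h0 : a 0 = 0) (h : ∀ i, 1 ≤ i → i ≤ m - 1 → a (i - 1) - 2 • a i + a (i + 1) = 0)
    (i : ℕ) (hi : i ≤ m) : a i = i • a 1 := by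
  induction i using Nat.strong_induction_on with
  | _ i ih =>
    match i with
    | 0 => simp [h0]
    | 1 => simp
    | k + 2 =>
      have h1 := h (k + 1) (by omega) (by omega)
      rw [Nat.add_sub_cancel, ih k (by omega) (by omega), ih (k + 1) (by omega) (by omega)] at h1
      have h2 : a (k + 2) = 2 • (k + 1) • a 1 - k • a 1 := by
        rw [← sub_eq_zero, ← h1]; abel
      rw [h2]
      module

/-- The homomorphism to `ZMod m` sending `z` to `0`, `e i` to `i` and `g i` to `-i`. -/
def phiToZMod (m : ℕ) : FreeAbelianGroup (PhiGen m) →+ ZMod m :=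
  FreeAbelianGroup.lift
    (Sum.elim (fun _ => 0)
      (Sum.elim (fun i => ((i.val + 1 : ℕ) : ZMod m)) (fun i => -((i.val + 1 : ℕ) : ZMod m))))

theorem phiToZMod_phiE (m i : ℕ) (hi : i ≤ m) : phiToZMod m (phiE m i) = i := by
  unfold phiE
  split_ifs with h h'
  · simp [phiToZMod, h]
  · simp only [phiToZMod, FreeAbelianGroup.lift_apply_of, Sum.elim_inr, Sum.elim_inl]
    rw [Nat.sub_add_cancel h'.1]
  · obtain rfl : i = m := by omega
    simp

theorem phiToZMod_phiG (m i : ℕ) (hi : i ≤ m) : phiToZMod m (phiG m i) = -i := by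
  unfold phiG
  split_ifs with h h'
  · simp [phiToZMod, h]
  · simp only [phiToZMod, FreeAbelianGroup.lift_apply_of, Sum.elim_inr]
    rw [Nat.sub_add_cancel h'.1]
  · obtain rfl : i = m := by omega
    simp

theorem closure_phiRels_le_ker_phiToZMod (m n : ℕ) (hm : 1 ≤ m) :
    AddSubgroup.closure (phiRels m n) ≤ (phiToZMod m).ker := by
  rw [AddSubgroup.closure_le]
  rintro w ((hw | ⟨i, h1, h2, rfl⟩) | ⟨i, h1, h2, rfl⟩)
  · obtain rfl := Set.mem_singleton_iff.mp hw
    simp [AddMonoidHom.mem_ker, phiToZMod_phiE, phiToZMod_phiG, hm]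
  · obtain ⟨k, rfl⟩ := Nat.exists_eq_add_of_le' h1
    simp only [SetLike.mem_coe, AddMonoidHom.mem_ker, map_add, map_sub, map_nsmul]
    rw [phiToZMod_phiE _ _ (by omega), phiToZMod_phiE _ _ (by omega),
      phiToZMod_phiE _ _ (by omega)]
    simp only [Nat.add_sub_cancel, nsmul_eq_mul]
    push_cast
    ring
  · obtain ⟨k, rfl⟩ := Nat.exists_eq_add_of_le' h1
    simp only [SetLike.mem_coe, AddMonoidHom.mem_ker, map_add, map_sub, map_nsmul]
    rw [phiToZMod_phiG _ _ (by omega), phiToZMod_phiG _ _ (by omega),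
      phiToZMod_phiG _ _ (by omega)]
    simp only [Nat.add_sub_cancel, nsmul_eq_mul]
    push_cast
    ring

/-- The quotient of `Φ(m,n)` by the subgroup generated by the class of `z`. -/
abbrev PhiModZ (m n : ℕ) : Type :=
  Phi m n ⧸ AddSubgroup.closure {(QuotientAddGroup.mk (phiE m 0) : Phi m n)}

/-- The projection from the free abelian group on the generators to `PhiModZ m n`. -/
def phiModZMk (m n : ℕ) : FreeAbelianGroup (PhiGen m) →+ PhiModZ m n :=
  (QuotientAddGroup.mk' _).comp (QuotientAddGroup.mk' _)

theorem phiModZMk_of_mem_phiRels {m n : ℕ} {w : FreeAbelianGroup (PhiGen m)}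
    (hw : w ∈ phiRels m n) : phiModZMk m n w = 0 := by
  have h : (QuotientAddGroup.mk' (AddSubgroup.closure (phiRels m n))) w = 0 :=
    (QuotientAddGroup.eq_zero_iff w).mpr (AddSubgroup.subset_closure hw)
  rw [phiModZMk, AddMonoidHom.comp_apply, h, map_zero]

theorem phiModZMk_phiE_zero (m n : ℕ) : phiModZMk m n (phiE m 0) = 0 :=
  (QuotientAddGroup.eq_zero_iff _).mpr (AddSubgroup.subset_closure rfl)

theorem phiModZMk_phiE (m n i : ℕ) (hi : i ≤ m) :
    phiModZMk m n (phiE m i) = i • phiModZMk m n (phiE m 1) := by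
  refine eq_nsmul_of_second_difference_eq_zero_s3 m (fun i => phiModZMk m n (phiE m i))
    (phiModZMk_phiE_zero m n) (fun i h1 h2 => ?_) i hi
  have := phiModZMk_of_mem_phiRels (n := n) (Or.inl (Or.inr ⟨i, h1, h2, rfl⟩))
  simpa only [map_add, map_sub, map_nsmul] using this

theorem phiModZMk_phiG (m n i : ℕ) (hi : i ≤ m) :
    phiModZMk m n (phiG m i) = -(i • phiModZMk m n (phiE m 1)) := by
  have h : phiModZMk m n (phiG m i) = i • phiModZMk m n (phiG m 1) := by
    refine eq_nsmul_of_second_difference_eq_zero_s3 m (fun i => phiModZMk m n (phiG m i))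
      (phiModZMk_phiE_zero m n) (fun i h1 h2 => ?_) i hi
    have := phiModZMk_of_mem_phiRels (n := n) (Or.inr ⟨i, h1, h2, rfl⟩)
    simpa only [map_add, map_sub, map_nsmul] using this
  have h1 := phiModZMk_of_mem_phiRels (m := m) (n := n) (Or.inl (Or.inl rfl))
  rw [map_sub, map_nsmul, phiModZMk_phiE_zero, nsmul_zero, sub_zero, map_add] at h1
  rw [h, eq_neg_of_add_eq_zero_right h1]
  exact neg_nsmul _ i

theorem nsmul_phiModZMk_phiE_one (m n : ℕ) : m • phiModZMk m n (phiE m 1) = 0 := by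
  rw [← phiModZMk_phiE m n m le_rfl]
  rcases Nat.eq_zero_or_pos m with rfl | hm
  · exact phiModZMk_phiE_zero 0 n
  · have h : phiE m m = 0 := by
      unfold phiE
      rw [if_neg (by omega), dif_neg (by omega)]
    rw [h, map_zero]

/-- The homomorphism from `PhiModZ m n` to `ZMod m` induced by `phiToZMod m`. -/
def phiModZToZMod (m n : ℕ) (hm : 1 ≤ m) : PhiModZ m n →+ ZMod m :=
  QuotientAddGroup.lift _
    (QuotientAddGroup.lift _ (phiToZMod m) (closure_phiRels_le_ker_phiToZMod m n hm)) <| by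
      rw [AddSubgroup.closure_le, Set.singleton_subset_iff]
      exact (phiToZMod_phiE m 0 m.zero_le).trans Nat.cast_zero

theorem phiModZToZMod_phiModZMk (m n : ℕ) (hm : 1 ≤ m) (w : FreeAbelianGroup (PhiGen m)) :
    phiModZToZMod m n hm (phiModZMk m n w) = phiToZMod m w :=
  rfl

/-- The homomorphism from `ZMod m` to `PhiModZ m n` sending `1` to the class of `e 1`. -/
def zmodToPhiModZ (m n : ℕ) : ZMod m →+ PhiModZ m n :=
  ZMod.lift m ⟨zmultiplesHom _ (phiModZMk m n (phiE m 1)), by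
    simpa using nsmul_phiModZMk_phiE_one m n⟩

theorem zmodToPhiModZ_natCast (m n k : ℕ) :
    zmodToPhiModZ m n k = k • phiModZMk m n (phiE m 1) := by
  have := ZMod.lift_coe m ⟨zmultiplesHom _ (phiModZMk m n (phiE m 1)), by
    simpa using nsmul_phiModZMk_phiE_one m n⟩ (k : ℤ)
  simpa [zmodToPhiModZ] using this

theorem zmodToPhiModZ_comp_phiToZMod (m n : ℕ) :
    (zmodToPhiModZ m n).comp (phiToZMod m) = phiModZMk m n := by
  ext x
  rcases x with u | i | i
  · have h : FreeAbelianGroup.of (Sum.inl u) = phiE m 0 := by simp [phiE]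
    rw [AddMonoidHom.comp_apply, h, phiToZMod_phiE _ _ m.zero_le, phiModZMk_phiE_zero,
      Nat.cast_zero, map_zero]
  · have hi := i.isLt
    have h : FreeAbelianGroup.of (Sum.inr (Sum.inl i)) = phiE m (i + 1) := by
      rw [phiE, if_neg (by omega), dif_pos (by omega)]; rfl
    rw [AddMonoidHom.comp_apply, h, phiToZMod_phiE _ _ (by omega), zmodToPhiModZ_natCast,
      ← phiModZMk_phiE _ _ _ (by omega)]
  · have hi := i.isLt
    have h : FreeAbelianGroup.of (Sum.inr (Sum.inr i)) = phiG m (i + 1) := by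
      rw [phiG, if_neg (by omega), dif_pos (by omega)]; rfl
    rw [AddMonoidHom.comp_apply, h, phiToZMod_phiG _ _ (by omega), map_neg, zmodToPhiModZ_natCast,
      ← phiModZMk_phiG _ _ _ (by omega)]

/-- The isomorphism between `PhiModZ m n` and `ZMod m`. -/
def phiModZEquivZMod (m n : ℕ) (hm : 1 ≤ m) : PhiModZ m n ≃+ ZMod m :=
  (phiModZToZMod m n hm).toAddEquiv (zmodToPhiModZ m n)
    (by
      ext x
      exact DFunLike.congr_fun (zmodToPhiModZ_comp_phiToZMod m n) (FreeAbelianGroup.of x))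
    (by
      have : NeZero m := ⟨by omega⟩
      ext x
      obtain ⟨k, rfl⟩ := ZMod.natCast_zmod_surjective x
      rw [AddMonoidHom.comp_apply, zmodToPhiModZ_natCast, map_nsmul, phiModZToZMod_phiModZMk,
        phiToZMod_phiE m 1 hm]
      simp)

/-- Theorem 4.3(iii) of the paper: for `m ≥ 1` and `n ≥ 2`, the quotient of `Φ(m,n)` by the
cyclic subgroup generated by the class of `z` is a cyclic group of order `m`. -/
theorem phi_quotient_z_cyclic (m n : ℕ) (hm : 1 ≤ m) (hn : 2 ≤ n) :
    Nat.card
      (Phi m n ⧸ AddSubgroup.closure {(QuotientAddGroup.mk (phiE m 0) : Phi m n)}) = m ∧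
    IsAddCyclic
      (Phi m n ⧸ AddSubgroup.closure {(QuotientAddGroup.mk (phiE m 0) : Phi m n)}) := by
  let e := phiModZEquivZMod m n hm
  exact ⟨(Nat.card_congr e.toEquiv).trans (Nat.card_zmod m),
    isAddCyclic_of_surjective e.symm e.symm.surjective⟩
end

section
/- Assume the elements z, e_1, …, e_{m−1}, g_1, …, g_{m−1} of G satisfy the component-group relations of parameters m, n. Then g_{m−1} = −(m(n−2)+1)•e_{m−1}. Moreover, the integers m(n−2)+1 and m(m(n−2)+2) are coprime: gcd(m(n−2)+1, m(m(n−2)+2)) = 1. -/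
/-- A sequence in an additive group with vanishing second differences on `[0, m]` and value `0`
at `m` is determined by its value at `m - 1`. -/
theorem apply_sub_eq_nsmul_of_second_diff_eq_zero {G : Type*} [AddCommGroup G] {m : ℕ} {f : ℕ → G}
    (hfm : f m = 0)
    (hf : ∀ i, 1 ≤ i → i ≤ m - 1 → f (i - 1) - 2 • f i + f (i + 1) = 0) :
    ∀ j ≤ m, f (m - j) = j • f (m - 1)
  | 0, _ => by simp [hfm]
  | 1, _ => by simp
  | j + 2, hj => by
    have h₁ := apply_sub_eq_nsmul_of_second_diff_eq_zero hfm hf (j + 1) (by omega)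
    have h₀ := apply_sub_eq_nsmul_of_second_diff_eq_zero hfm hf j (by omega)
    have h := hf (m - (j + 1)) (by omega) (by omega)
    rw [show m - (j + 1) - 1 = m - (j + 2) by omega, show m - (j + 1) + 1 = m - j by omega,
      h₁, h₀] at h
    rw [← sub_eq_zero, ← h]
    module

/-- If `a = m * k + 1`, then `a` is coprime to both `m` and `a + 1`. -/
theorem coprime_mul_add_one_mul_mul_add_two (m k : ℕ) :
    Nat.Coprime (m * k + 1) (m * (m * k + 2)) := by
  refine Nat.Coprime.mul_right ?_ ?_
  · simp
  · exact (Nat.coprime_self_add_right (m := m * k + 1) (n := 1)).2 (Nat.coprime_one_right _)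


/-- Remark after Theorem 4.3 of the paper: under the component-group relations of
parameters `m, n` (with conventions `e 0 = g 0 = z`, `e m = g m = 0`), one has
`g (m-1) = -(m(n-2)+1) • e (m-1)`, and `m(n-2)+1` is coprime to the order
`m(m(n-2)+2)` of the component group. -/
theorem component_group_other_generator {G : Type*} [AddCommGroup G]
    (m n : ℕ) (hm : 2 ≤ m) (hn : 2 ≤ n)
    (z : G) (e g : ℕ → G)
    (he0 : e 0 = z) (hg0 : g 0 = z) (hem : e m = 0) (hgm : g m = 0)
    (hrel : e 1 + g 1 = n • z)
    (hrece : ∀ i, 1 ≤ i → i ≤ m - 1 → e (i - 1) - 2 • e i + e (i + 1) = 0)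
    (hrecg : ∀ i, 1 ≤ i → i ≤ m - 1 → g (i - 1) - 2 • g i + g (i + 1) = 0) :
    g (m - 1) = (-((m : ℤ) * ((n : ℤ) - 2) + 1)) • e (m - 1) ∧
    Nat.gcd (m * (n - 2) + 1) (m * (m * (n - 2) + 2)) = 1 := by
  refine ⟨?_, coprime_mul_add_one_mul_mul_add_two m (n - 2)⟩
  have he := apply_sub_eq_nsmul_of_second_diff_eq_zero hem hrece
  have hg := apply_sub_eq_nsmul_of_second_diff_eq_zero hgm hrecg
  have hez := he m le_rfl
  have hgz := hg m le_rfl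
  have he1 := he (m - 1) (Nat.sub_le m 1)
  have hg1 := hg (m - 1) (Nat.sub_le m 1)
  rw [Nat.sub_self, he0] at hez
  rw [Nat.sub_self, hg0] at hgz
  rw [Nat.sub_sub_self (by omega)] at he1 hg1
  rw [he1, hg1] at hrel
  generalize e (m - 1) = x at *
  generalize g (m - 1) = y at *
  obtain ⟨k, rfl⟩ : ∃ k, m = k + 1 := ⟨m - 1, by omega⟩
  rw [Nat.add_sub_cancel] at hrel
  push_cast
  linear_combination (norm := module) (-1 : ℤ) • hgz - hrel - ((n : ℤ) - 1) • hez
end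

section
/- Let q ≥ 2 be an integer, let G be an additive abelian group, and let z, e_1, …, e_q, g_1, …, g_q be elements of G satisfying the component-group relations of parameters m = q+1 and n = q+1. Then g_1 − e_1 = (q²+1)•e_q and g_q − e_1 = −(q(q+1))•e_q. -/
/-- A sequence with vanishing second differences on `0, …, q + 1` and value `0` at `q + 1`
is linear in the distance to `q + 1`. -/
theorem eq_zsmul_of_second_difference_eq_zero {G : Type*} [AddCommGroup G] {q : ℕ} {f : ℕ → G}
    (hf : f (q + 1) = 0)
    (hrec : ∀ i, 1 ≤ i → i ≤ q → f (i - 1) - 2 • f i + f (i + 1) = 0)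
    (i j : ℕ) (hij : i + j = q) : f i = ((j : ℤ) + 1) • f q := by
  suffices h : f i = ((j : ℤ) + 1) • f q ∧ f (i + 1) = (j : ℤ) • f q from h.1
  induction j generalizing i with
  | zero =>
    obtain rfl : i = q := hij
    simp [hf]
  | succ j ih =>
    obtain ⟨h₁, h₂⟩ := ih (i + 1) (by omega)
    have h := hrec (i + 1) (by omega) (by omega)
    rw [Nat.add_sub_cancel] at h
    push_cast
    refine ⟨?_, h₁⟩
    linear_combination (norm := module) h + (2 : ℤ) • h₁ - h₂

/-- The computation in Theorem 3.8(ii) of the paper: for the component-group relations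
of parameters `m = n = q + 1` (with conventions `e 0 = g 0 = z`, `e (q+1) = g (q+1) = 0`),
one has `g 1 - e 1 = (q² + 1) • e q` and `g q - e 1 = -(q(q+1)) • e q`. -/
theorem component_group_cusp_images {G : Type*} [AddCommGroup G]
    (q : ℕ) (hq : 2 ≤ q)
    (z : G) (e g : ℕ → G)
    (he0 : e 0 = z) (hg0 : g 0 = z) (hem : e (q + 1) = 0) (hgm : g (q + 1) = 0)
    (hrel : e 1 + g 1 = (q + 1) • z)
    (hrece : ∀ i, 1 ≤ i → i ≤ q → e (i - 1) - 2 • e i + e (i + 1) = 0)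
    (hrecg : ∀ i, 1 ≤ i → i ≤ q → g (i - 1) - 2 • g i + g (i + 1) = 0) :
    g 1 - e 1 = (q ^ 2 + 1) • e q ∧
    g q - e 1 = (-((q : ℤ) * ((q : ℤ) + 1))) • e q := by
  have he_one := eq_zsmul_of_second_difference_eq_zero hem hrece 1 (q - 1) (by omega)
  have he_zero := eq_zsmul_of_second_difference_eq_zero hem hrece 0 q (by omega)
  have hg_one := eq_zsmul_of_second_difference_eq_zero hgm hrecg 1 (q - 1) (by omega)
  have hg_zero := eq_zsmul_of_second_difference_eq_zero hgm hrecg 0 q (by omega)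
  rw [Nat.cast_sub (by omega), Nat.cast_one, sub_add_cancel] at he_one hg_one
  rw [he0] at he_zero
  rw [hg0] at hg_zero
  have hg_one' : g 1 = ((q : ℤ) ^ 2 + q + 1) • e q := by
    linear_combination (norm := module) hrel - he_one + ((q : ℤ) + 1) • he_zero
  have hg_last : g q = (-(q : ℤ) ^ 2) • e q := by
    linear_combination (norm := module) he_zero - hg_zero + hg_one - hg_one'
  constructor
  · linear_combination (norm := module) hg_one' - he_one
  · linear_combination (norm := module) hg_last - he_one
end

section
/- Let K be a finite field with q elements and let L be a field extension of K of degree 2. Consider the diagonal action of GL₂(K) on ℙ¹(K) × ℙ¹(L). This action has exactly three orbits, namely: O₁ = {(P, ι(P)) : P ∈ ℙ¹(K)}, of cardinality q+1; O₂ = {(P, ι(P′)) : P, P′ ∈ ℙ¹(K), P ≠ P′}, of cardinality q(q+1); and O₃ = {(P, Q) : P ∈ ℙ¹(K), Q ∈ ℙ¹(L), Q not in the image of ι}, of cardinality q(q²−1). -/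
open scoped LinearAlgebra.Projectivization

/-- The action of `GL₂(F)` on the projective line `ℙ¹(F) = ℙ F (Fin 2 → F)`, induced by the
linear action of an invertible matrix on `F²`. -/
noncomputable def pact {F : Type*} [Field F] (g : GL (Fin 2) F) :
    ℙ F (Fin 2 → F) → ℙ F (Fin 2 → F) :=
  Projectivization.map
    ((Matrix.GeneralLinearGroup.toLin g : LinearMap.GeneralLinearGroup F (Fin 2 → F)) :
      (Fin 2 → F) →ₗ[F] (Fin 2 → F))
    (LinearMap.GeneralLinearGroup.toLinearEquiv (Matrix.GeneralLinearGroup.toLin g)).injective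

/-- The semilinear map `K² → L²` induced by the inclusion of a field `K` into an extension
field `L`. -/
def baseChangeSL (K L : Type*) [Field K] [Field L] [Algebra K L] :
    (Fin 2 → K) →ₛₗ[algebraMap K L] (Fin 2 → L) where
  toFun v := fun i => algebraMap K L (v i)
  map_add' u v := by funext i; simp
  map_smul' a v := by funext i; simp [Algebra.smul_def]

/-- The injection `ι : ℙ¹(K) → ℙ¹(L)` induced by the inclusion `K² ⊆ L²`. -/
noncomputable def iotaP (K L : Type*) [Field K] [Field L] [Algebra K L] :
    ℙ K (Fin 2 → K) → ℙ L (Fin 2 → L) :=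
  Projectivization.map (baseChangeSL K L)
    (fun u v huv => funext fun i => (algebraMap K L).injective (congrFun huv i))

/-- The diagonal action of `g ∈ GL₂(K)` on `ℙ¹(K) × ℙ¹(L)`, acting on the second factor
through the inclusion `GL₂(K) → GL₂(L)`. -/
noncomputable def diagAct {K L : Type*} [Field K] [Field L] [Algebra K L]
    (g : GL (Fin 2) K) (p : ℙ K (Fin 2 → K) × ℙ L (Fin 2 → L)) :
    ℙ K (Fin 2 → K) × ℙ L (Fin 2 → L) :=
  (pact g p.1, pact (Matrix.GeneralLinearGroup.map (algebraMap K L) g) p.2)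

/-- The orbit of a point of `ℙ¹(K) × ℙ¹(L)` under the diagonal action of `GL₂(K)`. -/
noncomputable def glOrbit {K L : Type*} [Field K] [Field L] [Algebra K L]
    (p : ℙ K (Fin 2 → K) × ℙ L (Fin 2 → L)) :
    Set (ℙ K (Fin 2 → K) × ℙ L (Fin 2 → L)) :=
  {p' | ∃ g : GL (Fin 2) K, diagAct g p = p'}

open Projectivization

section ProjectiveLine

variable {F : Type*} [Field F]

/-- Two nonzero vectors of `F²` span the same line iff their determinant vanishes. -/
theorem mk_eq_mk_iff_cross {v w : Fin 2 → F} (hv : v ≠ 0) (hw : w ≠ 0) :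
    mk F v hv = mk F w hw ↔ v 0 * w 1 = v 1 * w 0 := by
  rw [mk_eq_mk_iff']
  constructor
  · rintro ⟨a, rfl⟩
    simp only [Pi.smul_apply, smul_eq_mul]
    ring
  · intro h
    by_cases h0 : w 0 = 0
    · have h1 : w 1 ≠ 0 := fun h1 => hw (by ext i; fin_cases i <;> simp [h0, h1])
      have hv0 : v 0 = 0 := by simpa [h0, h1] using h
      refine ⟨v 1 / w 1, ?_⟩
      ext i
      fin_cases i <;> simp [h0, h1, hv0]
    · refine ⟨v 0 / w 0, ?_⟩
      ext i
      fin_cases i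
      · simp [h0]
      · simp only [Fin.mk_one, Pi.smul_apply, smul_eq_mul]
        field_simp
        linear_combination h

theorem pact_eq_smul (g : GL (Fin 2) F) (P : ℙ F (Fin 2 → F)) :
    pact g P = Matrix.GeneralLinearGroup.toLin g • P :=
  rfl

theorem pact_inv_pact (g : GL (Fin 2) F) (P : ℙ F (Fin 2 → F)) : pact g⁻¹ (pact g P) = P := by
  simp only [pact_eq_smul, map_inv, inv_smul_smul]

theorem mulVec_ne_zero (g : GL (Fin 2) F) {v : Fin 2 → F} (hv : v ≠ 0) :
    g.1.mulVec v ≠ 0 := fun h =>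
  hv (Matrix.mulVec_injective_of_isUnit g.isUnit (by rw [h, Matrix.mulVec_zero]))

theorem pact_mk (g : GL (Fin 2) F) {v : Fin 2 → F} (hv : v ≠ 0) :
    pact g (mk F v hv) = mk F (g.1.mulVec v) (mulVec_ne_zero g hv) :=
  rfl

theorem exists_pact_eq (P P' : ℙ F (Fin 2 → F)) : ∃ g : GL (Fin 2) F, pact g P = P' := by
  have : MulAction.IsPretransitive (LinearMap.GeneralLinearGroup F (Fin 2 → F))
      (ℙ F (Fin 2 → F)) := MulAction.isPretransitive_of_is_two_pretransitive
  obtain ⟨f, hf⟩ := MulAction.exists_smul_eq (LinearMap.GeneralLinearGroup F (Fin 2 → F)) P P'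
  obtain ⟨g, rfl⟩ := Matrix.GeneralLinearGroup.toLin.surjective f
  exact ⟨g, hf⟩

theorem exists_pact_eq_pact_eq {P Q P' Q' : ℙ F (Fin 2 → F)} (h : P ≠ Q) (h' : P' ≠ Q') :
    ∃ g : GL (Fin 2) F, pact g P = P' ∧ pact g Q = Q' := by
  obtain ⟨f, hf⟩ := MulAction.is_two_pretransitive_iff.mp
    (generalLinearGroup_is_two_pretransitive F (Fin 2 → F)) h h'
  obtain ⟨g, rfl⟩ := Matrix.GeneralLinearGroup.toLin.surjective f
  exact ⟨g, hf⟩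

end ProjectiveLine

section Extension

variable {K L : Type*} [Field K] [Field L] [Algebra K L]

theorem baseChangeSL_ne_zero {v : Fin 2 → K} (hv : v ≠ 0) : baseChangeSL K L v ≠ 0 := fun h =>
  hv (funext fun i => (algebraMap K L).injective ((congrFun h i).trans (map_zero _).symm))

theorem iotaP_mk {v : Fin 2 → K} (hv : v ≠ 0) :
    iotaP K L (mk K v hv) = mk L (baseChangeSL K L v) (baseChangeSL_ne_zero hv) :=
  rfl

theorem iotaP_injective : Function.Injective (iotaP K L) := by
  intro P P' h
  induction P using Projectivization.ind with | _ v hv =>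
  induction P' using Projectivization.ind with | _ w hw =>
  rw [iotaP_mk, iotaP_mk, mk_eq_mk_iff_cross] at h
  rw [mk_eq_mk_iff_cross]
  apply (algebraMap K L).injective
  simpa only [map_mul] using! h

theorem pact_map_iotaP (g : GL (Fin 2) K) (P : ℙ K (Fin 2 → K)) :
    pact (Matrix.GeneralLinearGroup.map (algebraMap K L) g) (iotaP K L P) =
      iotaP K L (pact g P) := by
  induction P using Projectivization.ind with | _ v hv =>
  simp only [iotaP_mk, pact_mk]
  congr 1
  ext i
  fin_cases i <;> simp [baseChangeSL, Matrix.mulVec, dotProduct]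

theorem pact_map_mem_range_iotaP_iff (g : GL (Fin 2) K) (Q : ℙ L (Fin 2 → L)) :
    pact (Matrix.GeneralLinearGroup.map (algebraMap K L) g) Q ∈ Set.range (iotaP K L) ↔
      Q ∈ Set.range (iotaP K L) := by
  constructor
  · rintro ⟨P, hP⟩
    refine ⟨pact g⁻¹ P, ?_⟩
    rw [← pact_map_iotaP, hP, map_inv, pact_inv_pact]
  · rintro ⟨P, rfl⟩
    exact ⟨pact g P, (pact_map_iotaP g P).symm⟩

/-- The `K`-linear map `K² → L` sending `v` to the determinant of `v` and `w ∈ L²`. -/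
def crossMap (K : Type*) {L : Type*} [Field K] [Field L] [Algebra K L] (w : Fin 2 → L) :
    (Fin 2 → K) →ₗ[K] L where
  toFun v := v 0 • w 1 - v 1 • w 0
  map_add' u v := by simp only [Pi.add_apply]; module
  map_smul' a v := by simp only [Pi.smul_apply, smul_eq_mul, RingHom.id_apply]; module

theorem crossMap_apply (w : Fin 2 → L) (v : Fin 2 → K) :
    crossMap K w v = v 0 • w 1 - v 1 • w 0 :=
  rfl

theorem crossMap_injective {w : Fin 2 → L} (hw : w ≠ 0)
    (h : mk L w hw ∉ Set.range (iotaP K L)) : Function.Injective (crossMap K w) := by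
  rw [injective_iff_map_eq_zero]
  intro v hv
  by_contra hv0
  refine h ⟨mk K v hv0, ?_⟩
  rw [iotaP_mk, mk_eq_mk_iff_cross]
  simpa [crossMap_apply, sub_eq_zero, Algebra.smul_def] using! hv

/-- If the determinant with `w'` pulls back along `g` to the determinant with `w`, then `g` maps
the line of `w` to the line of `w'`. -/
theorem pact_map_mk_of_crossMap {g : GL (Fin 2) K} {w w' : Fin 2 → L} (hw : w ≠ 0) (hw' : w' ≠ 0)
    (h : ∀ v, crossMap K w' (g.1.mulVec v) = crossMap K w v) :
    pact (Matrix.GeneralLinearGroup.map (algebraMap K L) g) (mk L w hw) = mk L w' hw' := by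
  rw [pact_mk, mk_eq_mk_iff_cross]
  have h0 := h (Pi.single 0 1)
  have h1 := h (Pi.single 1 1)
  simp [crossMap_apply, Algebra.smul_def] at h0 h1
  simp [Matrix.mulVec, dotProduct]
  linear_combination w 0 * h0 + w 1 * h1

/-- `GL₂(K)` is transitive on the pairs `(P, Q)` where `Q` is not `K`-rational. -/
theorem exists_diagAct_eq_of_notMem_range (hdim : Module.finrank K L = 2)
    {p p' : ℙ K (Fin 2 → K) × ℙ L (Fin 2 → L)} (hp : p.2 ∉ Set.range (iotaP K L))
    (hp' : p'.2 ∉ Set.range (iotaP K L)) : ∃ g : GL (Fin 2) K, diagAct g p = p' := by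
  have : FiniteDimensional K L := Module.finite_of_finrank_eq_succ hdim
  obtain ⟨P, Q⟩ := p
  obtain ⟨P', Q'⟩ := p'
  induction P using Projectivization.ind with | _ u hu =>
  induction P' using Projectivization.ind with | _ u' hu' =>
  induction Q using Projectivization.ind with | _ w hw =>
  induction Q' using Projectivization.ind with | _ w' hw' =>
  have hinj := crossMap_injective hw hp
  have hinj' := crossMap_injective hw' hp'
  have hne : crossMap K w u ≠ 0 := by rwa [Ne, map_eq_zero_iff _ hinj]
  have hne' : crossMap K w' u' ≠ 0 := by rwa [Ne, map_eq_zero_iff _ hinj']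
  set c : L := crossMap K w u / crossMap K w' u' with hc
  have hc0 : c ≠ 0 := div_ne_zero hne hne'
  have hcw : c • w' ≠ 0 := smul_ne_zero hc0 hw'
  have hQ' : mk L w' hw' = mk L (c • w') hcw := by
    rw [mk_eq_mk_iff_cross]
    simp only [Pi.smul_apply, smul_eq_mul]
    ring
  simp only [hQ'] at hp' ⊢
  have hfin : Module.finrank K (Fin 2 → K) = Module.finrank K L := by simp [hdim]
  let e := LinearEquiv.ofInjectiveOfFinrankEq (crossMap K w) hinj hfin
  let e' := LinearEquiv.ofInjectiveOfFinrankEq (crossMap K (c • w'))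
    (crossMap_injective hcw hp') hfin
  obtain ⟨g, hg⟩ := Matrix.GeneralLinearGroup.toLin.surjective
    (LinearMap.GeneralLinearGroup.ofLinearEquiv (e.trans e'.symm))
  have hgv (v : Fin 2 → K) : g.1.mulVec v = e'.symm (e v) :=
    congrArg (fun f : LinearMap.GeneralLinearGroup K (Fin 2 → K) => f.1 v) hg
  have hgc (v : Fin 2 → K) : crossMap K (c • w') (g.1.mulVec v) = crossMap K w v := by
    rw [hgv]
    exact e'.apply_symm_apply (e v)
  refine ⟨g, Prod.ext ?_ (pact_map_mk_of_crossMap hw hcw hgc)⟩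
  have hgu : g.1.mulVec u = u' := by
    apply crossMap_injective hcw hp'
    rw [hgc]
    have : crossMap K (c • w') u' = c * crossMap K w' u' := by
      simp only [crossMap_apply, Pi.smul_apply, Algebra.smul_def (R := K), smul_eq_mul]
      ring
    rw [this, hc, div_mul_cancel₀ _ hne']
  simp only [diagAct, pact_mk, hgu]

/-- A nonempty stable set on which `GL₂(K)` is transitive is the orbit of each of its points. -/
theorem glOrbit_eq_of_mem {O : Set (ℙ K (Fin 2 → K) × ℙ L (Fin 2 → L))}
    (hstable : ∀ (g : GL (Fin 2) K), ∀ p ∈ O, diagAct g p ∈ O)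
    (htrans : ∀ p ∈ O, ∀ p' ∈ O, ∃ g : GL (Fin 2) K, diagAct g p = p')
    {p : ℙ K (Fin 2 → K) × ℙ L (Fin 2 → L)} (hp : p ∈ O) : glOrbit p = O := by
  ext p'
  constructor
  · rintro ⟨g, rfl⟩
    exact hstable g p hp
  · exact htrans p hp p'

end Extension

/-- Section 5.2 of the paper: if `K` is a finite field with `q` elements and `L/K` is a
quadratic extension, then the diagonal action of `GL₂(K)` on `ℙ¹(K) × ℙ¹(L)` has exactly
three orbits: the "diagonal" `O₁ = {(P, ι P)}` of cardinality `q + 1`, the set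
`O₂ = {(P, ι P') : P ≠ P'}` of cardinality `q(q+1)`, and the set `O₃` of pairs whose
second coordinate is not in the image of `ι`, of cardinality `q(q² - 1)`. -/
theorem gl2_orbits_on_P1K_P1L (K L : Type*) [Field K] [Field L] [Algebra K L]
    [Fintype K] (q : ℕ) (hq : Fintype.card K = q) (hdim : Module.finrank K L = 2) :
    let O₁ : Set (ℙ K (Fin 2 → K) × ℙ L (Fin 2 → L)) :=
      {p | ∃ P, p = (P, iotaP K L P)}
    let O₂ : Set (ℙ K (Fin 2 → K) × ℙ L (Fin 2 → L)) :=
      {p | ∃ P P', P ≠ P' ∧ p = (P, iotaP K L P')}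
    let O₃ : Set (ℙ K (Fin 2 → K) × ℙ L (Fin 2 → L)) :=
      {p | p.2 ∉ Set.range (iotaP K L)}
    (∀ p, glOrbit p = O₁ ∨ glOrbit p = O₂ ∨ glOrbit p = O₃) ∧
    (∃ p, glOrbit p = O₁) ∧ (∃ p, glOrbit p = O₂) ∧ (∃ p, glOrbit p = O₃) ∧
    Nat.card O₁ = q + 1 ∧ Nat.card O₂ = q * (q + 1) ∧ Nat.card O₃ = q * (q ^ 2 - 1) := by
  intro O₁ O₂ O₃
  have orb₁ : ∀ p ∈ O₁, glOrbit p = O₁ := fun p => glOrbit_eq_of_mem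
    (by
      rintro g _ ⟨P, rfl⟩
      exact ⟨pact g P, Prod.ext rfl (pact_map_iotaP g P)⟩)
    (by
      rintro _ ⟨P, rfl⟩ _ ⟨P', rfl⟩
      obtain ⟨g, rfl⟩ := exists_pact_eq P P'
      exact ⟨g, Prod.ext rfl (pact_map_iotaP g P)⟩)
  have orb₂ : ∀ p ∈ O₂, glOrbit p = O₂ := fun p => glOrbit_eq_of_mem
    (by
      rintro g _ ⟨P, P', h, rfl⟩
      exact ⟨pact g P, pact g P', (Function.LeftInverse.injective (pact_inv_pact g)).ne h,
        Prod.ext rfl (pact_map_iotaP g P')⟩)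
    (by
      rintro _ ⟨P, P', h, rfl⟩ _ ⟨R, R', h', rfl⟩
      obtain ⟨g, rfl, rfl⟩ := exists_pact_eq_pact_eq h h'
      exact ⟨g, Prod.ext rfl (pact_map_iotaP g P')⟩)
  have orb₃ : ∀ p ∈ O₃, glOrbit p = O₃ := fun p => glOrbit_eq_of_mem
    (fun g p hp => (pact_map_mem_range_iotaP_iff g p.2).not.mpr hp)
    (fun p hp p' hp' => exists_diagAct_eq_of_notMem_range hdim hp hp')
  have : FiniteDimensional K L := Module.finite_of_finrank_eq_succ hdim
  have : Finite L := Module.finite_of_finite K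
  have hqK : Nat.card K = q := by rw [Nat.card_eq_fintype_card, hq]
  have hq1 : 1 < q := hqK ▸ Finite.one_lt_card
  have hPK : Nat.card (ℙ K (Fin 2 → K)) = q + 1 := by
    rw [card_of_finrank_two K _ (by simp), hqK]
  have hPL : Nat.card (ℙ L (Fin 2 → L)) = q ^ 2 + 1 := by
    rw [card_of_finrank_two L _ (by simp), Module.natCard_eq_pow_finrank (K := K), hdim, hqK]
  have hrange : (Set.range (iotaP K L)).ncard = q + 1 := by
    rw [← Nat.card_coe_set_eq, Nat.card_range_of_injective iotaP_injective, hPK]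
  have card₁ : Nat.card O₁ = q + 1 := by
    have : O₁ = Set.range fun P => (P, iotaP K L P) := by
      ext p
      exact exists_congr fun P => eq_comm
    rw [this, Nat.card_range_of_injective (fun P P' h => congrArg Prod.fst h), hPK]
  have card₂ : Nat.card O₂ = q * (q + 1) := by
    have hunion : O₁ ∪ O₂ = Set.univ ×ˢ Set.range (iotaP K L) := by
      ext ⟨P, Q⟩
      constructor
      · rintro (⟨R, h⟩ | ⟨R, R', -, h⟩) <;> cases h <;> simp
      · rintro ⟨-, P', rfl⟩
        by_cases h : P = P'
        · exact Or.inl ⟨P, by rw [h]⟩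
        · exact Or.inr ⟨P, P', h, rfl⟩
    have hdisj : Disjoint O₁ O₂ := by
      rw [Set.disjoint_left]
      rintro _ ⟨P, rfl⟩ ⟨R, R', hne, h⟩
      obtain ⟨hP, hQ⟩ := Prod.mk.inj h
      exact hne (hP.symm.trans (iotaP_injective hQ))
    have hcard := Set.ncard_union_eq hdisj
    rw [hunion, Set.ncard_prod, Set.ncard_univ, hPK, hrange, ← Nat.card_coe_set_eq O₁,
      card₁] at hcard
    rw [Nat.card_coe_set_eq]
    linarith
  have card₃ : Nat.card O₃ = q * (q ^ 2 - 1) := by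
    have : O₃ = Set.univ ×ˢ (Set.range (iotaP K L))ᶜ := by
      ext p
      simp [O₃]
    rw [Nat.card_coe_set_eq, this, Set.ncard_prod, Set.ncard_univ, Set.ncard_compl, hPK, hPL,
      hrange]
    have h1 : q + 1 ≤ q ^ 2 + 1 := by nlinarith
    have h2 : 1 ≤ q ^ 2 := by nlinarith
    zify [h1, h2]
    ring
  have exists_orbit {O : Set (ℙ K (Fin 2 → K) × ℙ L (Fin 2 → L))}
      (orb : ∀ p ∈ O, glOrbit p = O) (hO : Nat.card O ≠ 0) : ∃ p, glOrbit p = O := by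
    obtain ⟨p⟩ := (Nat.card_ne_zero.mp hO).1
    exact ⟨p, orb p p.2⟩
  refine ⟨fun p => ?_, exists_orbit orb₁ (by lia), exists_orbit orb₂ ?_, exists_orbit orb₃ ?_,
    card₁, card₂, card₃⟩
  · by_cases hp : p.2 ∈ Set.range (iotaP K L)
    · obtain ⟨P', hP'⟩ := hp
      by_cases h : p.1 = P'
      · exact Or.inl (orb₁ p ⟨p.1, Prod.ext rfl (by rw [h, hP'])⟩)
      · exact Or.inr (Or.inl (orb₂ p ⟨p.1, P', h, Prod.ext rfl hP'.symm⟩))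
    · exact Or.inr (Or.inr (orb₃ p hp))
  · rw [card₂]
    positivity
  · rw [card₃]
    exact Nat.mul_ne_zero (by lia) (Nat.sub_ne_zero_of_lt (by nlinarith))
end

section
/- Let q ≥ 2 be an integer. Let C be an additive abelian group generated by two elements a and b satisfying (q+1)•a = 0 and (q²+1)•b = 0. Assume there exist group homomorphisms f : C → ℤ/(q+1)ℤ with f(a) = 1 and f(b) = 0, and g : C → ℤ/(q²+1)(q+1)ℤ with g(a) = 0 and such that g(b) has additive order q²+1. Then a has order q+1 in C, b has order q²+1 in C, the cyclic subgroups generated by a and by b intersect trivially, and C is isomorphic to ℤ/(q+1)ℤ × ℤ/(q²+1)ℤ. -/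
/-- An additive commutative group generated by two elements whose cyclic subgroups intersect
trivially is the product of the cyclic groups given by the orders of the generators. -/
theorem nonempty_addEquiv_zmod_prod_of_closure_pair_eq_top {C : Type*} [AddCommGroup C] {a b : C}
    (hgen : AddSubgroup.closure ({a, b} : Set C) = ⊤)
    (hab : AddSubgroup.zmultiples a ⊓ AddSubgroup.zmultiples b = ⊥) :
    Nonempty (C ≃+ ZMod (addOrderOf a) × ZMod (addOrderOf b)) := by
  let φ (c : C) : ZMod (addOrderOf c) →+ C :=
    ZMod.lift (addOrderOf c) ⟨zmultiplesHom C c, by simp⟩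
  have hφ (c : C) (i : ℤ) : φ c i = i • c := by simp [φ]
  refine ⟨(AddEquiv.ofBijective ((φ a).coprod (φ b)) ⟨?_, fun c => ?_⟩).symm⟩
  · rw [injective_iff_map_eq_zero]
    rintro ⟨x, y⟩ h
    obtain ⟨i, rfl⟩ := ZMod.intCast_surjective x
    obtain ⟨j, rfl⟩ := ZMod.intCast_surjective y
    rw [AddMonoidHom.coprod_apply, hφ, hφ] at h
    have hi : i • a = 0 := by
      rw [← AddSubgroup.mem_bot, ← hab]
      refine ⟨⟨i, rfl⟩, ⟨-j, ?_⟩⟩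
      simpa using (eq_neg_of_add_eq_zero_left h).symm
    have hj : j • b = 0 := by simpa [hi] using h
    rw [Prod.mk_eq_zero, CharP.intCast_eq_zero_iff _ (addOrderOf _), CharP.intCast_eq_zero_iff _ (addOrderOf _)]
    exact ⟨addOrderOf_dvd_iff_zsmul_eq_zero.mpr hi, addOrderOf_dvd_iff_zsmul_eq_zero.mpr hj⟩
  · obtain ⟨i, j, rfl⟩ := AddSubgroup.mem_closure_pair.mp (hgen ▸ AddSubgroup.mem_top c)
    exact ⟨(i, j), by rw [AddMonoidHom.coprod_apply, hφ, hφ]⟩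

/-- The group-theoretic content of Theorem 3.6 of the paper.  Let `q ≥ 2` and let `C` be
an abelian group generated by `a`, `b` with `(q+1) • a = 0` and `(q²+1) • b = 0`.  If
there are homomorphisms `f : C → ℤ/(q+1)ℤ` with `f a = 1`, `f b = 0`, and
`g : C → ℤ/(q²+1)(q+1)ℤ` with `g a = 0` and `g b` of additive order `q²+1`, then `a`
has order `q+1`, `b` has order `q²+1`, the cyclic subgroups generated by `a` and `b`
intersect trivially, and `C ≅ ℤ/(q+1)ℤ × ℤ/(q²+1)ℤ`. -/
theorem cuspidal_divisor_group_structure {C : Type*} [AddCommGroup C]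
    (q : ℕ) (hq : 2 ≤ q) (a b : C)
    (hgen : AddSubgroup.closure ({a, b} : Set C) = ⊤)
    (ha : (q + 1) • a = 0) (hb : (q ^ 2 + 1) • b = 0)
    (f : C →+ ZMod (q + 1)) (hfa : f a = 1) (hfb : f b = 0)
    (g : C →+ ZMod ((q ^ 2 + 1) * (q + 1))) (hga : g a = 0)
    (hgb : addOrderOf (g b) = q ^ 2 + 1) :
    addOrderOf a = q + 1 ∧ addOrderOf b = q ^ 2 + 1 ∧
    AddSubgroup.zmultiples a ⊓ AddSubgroup.zmultiples b = ⊥ ∧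
    Nonempty (C ≃+ ZMod (q + 1) × ZMod (q ^ 2 + 1)) := by
  have hoa : addOrderOf a = q + 1 := by
    refine Nat.dvd_antisymm (addOrderOf_dvd_of_nsmul_eq_zero ha) ?_
    rw [← ZMod.addOrderOf_one (q + 1), ← hfa]
    exact addOrderOf_map_dvd f a
  have hob : addOrderOf b = q ^ 2 + 1 := by
    refine Nat.dvd_antisymm (addOrderOf_dvd_of_nsmul_eq_zero hb) ?_
    rw [← hgb]
    exact addOrderOf_map_dvd g b
  have hab : AddSubgroup.zmultiples a ⊓ AddSubgroup.zmultiples b = ⊥ := by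
    rw [eq_bot_iff]
    rintro _ ⟨⟨i, rfl⟩, ⟨j, h⟩⟩
    have h0 : (i : ZMod (q + 1)) = 0 := by simpa [hfa, hfb] using (congrArg f h).symm
    rw [CharP.intCast_eq_zero_iff _ (q + 1), ← hoa] at h0
    exact addOrderOf_dvd_iff_zsmul_eq_zero.mp h0
  refine ⟨hoa, hob, hab, ?_⟩
  rw [← hoa, ← hob]
  exact nonempty_addEquiv_zmod_prod_of_closure_pair_eq_top hgen hab
end
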